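/- arXiv:2107.10594 — 4 statements merged into one kernel-verified Lean document; each statement's English description precedes it below -/
import Mathlib

section
/- Let α be real with |α| > 1, let ψ : ℤ → ℂ be rapidly decaying, and set u(β) = (S(β) − 1) ψ(β). Then Σ_β (S(β) − 1)² |ψ(β−1) − ψ(β+1)|² ≤ 2 Σ_β |u(β−1) − u(β+1)|² + 8 Σ_β |ψ(β)|². -/
/-- `S(β) = (α² + β²)^{1/2}`. -/
noncomputable def Sv (α : ℝ) (β : ℤ) : ℝ := Real.sqrt (α ^ 2 + (β : ℝ) ^ 2)

/-- A sequence `ψ : ℤ → ℂ` is rapidly decaying if `Σ_β (1+β²)^k |ψ(β)|² < ∞` for all `k`. -/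
def RapidlyDecayingSeq (ψ : ℤ → ℂ) : Prop :=
  ∀ k : ℕ, Summable (fun β : ℤ => (1 + (β : ℝ) ^ 2) ^ k * ‖ψ β‖ ^ 2)

/-- `u(β) = (S(β) − 1) ψ(β)`. -/
noncomputable def useq (α : ℝ) (ψ : ℤ → ℂ) (β : ℤ) : ℂ := ((Sv α β - 1 : ℝ) : ℂ) * ψ β

theorem Sv_step (α : ℝ) (b c : ℤ) (h : |(b : ℝ) - c| ≤ 1) : Sv α b ≤ Sv α c + 1 := by
  have h0 : 0 ≤ Sv α c := Real.sqrt_nonneg _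
  have h1 : Sv α c ^ 2 = α ^ 2 + (c : ℝ) ^ 2 := Real.sq_sqrt (by positivity)
  have h2 : |(c : ℝ)| ≤ Sv α c := Real.abs_le_sqrt (by nlinarith [sq_nonneg α])
  have h3 : |(b : ℝ)| ≤ |(c : ℝ)| + 1 := by
    have := abs_sub_abs_le_abs_sub (b : ℝ) c
    linarith
  have h4 : 0 ≤ |(b : ℝ)| := abs_nonneg _
  unfold Sv at *
  rw [Real.sqrt_le_left (by linarith)]
  nlinarith [sq_abs (b : ℝ), sq_abs (c : ℝ)]

theorem Sv_abs (α : ℝ) (b c : ℤ) (h : |(b : ℝ) - c| ≤ 1) : |Sv α b - Sv α c| ≤ 1 := by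
  rw [abs_le]
  constructor
  · linarith [Sv_step α c b (by rwa [abs_sub_comm])]
  · linarith [Sv_step α b c h]

theorem norm_sq_sub_le (x y : ℂ) : ‖x - y‖ ^ 2 ≤ 2 * ‖x‖ ^ 2 + 2 * ‖y‖ ^ 2 := by
  have := norm_sub_le x y
  nlinarith [sq_nonneg (‖x‖ - ‖y‖), norm_nonneg (x - y), norm_nonneg x, norm_nonneg y]

theorem pointwise_bd (α : ℝ) (ψ : ℤ → ℂ) (β : ℤ) :
    (Sv α β - 1) ^ 2 * ‖ψ (β - 1) - ψ (β + 1)‖ ^ 2 ≤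
      2 * ‖useq α ψ (β - 1) - useq α ψ (β + 1)‖ ^ 2
        + (4 * ‖ψ (β - 1)‖ ^ 2 + 4 * ‖ψ (β + 1)‖ ^ 2) := by
  have e : (Sv α β - 1) ^ 2 * ‖ψ (β - 1) - ψ (β + 1)‖ ^ 2
      = ‖(useq α ψ (β - 1) - useq α ψ (β + 1)) -
        (((Sv α (β - 1) - Sv α β : ℝ) : ℂ) * ψ (β - 1)
          - ((Sv α (β + 1) - Sv α β : ℝ) : ℂ) * ψ (β + 1))‖ ^ 2 := by
    rw [← sq_abs (Sv α β - 1), ← Real.norm_eq_abs, ← Complex.norm_real, ← mul_pow, ← norm_mul]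
    congr 2
    unfold useq
    push_cast
    ring
  rw [e]
  have k1 : ‖((Sv α (β - 1) - Sv α β : ℝ) : ℂ) * ψ (β - 1)‖ ≤ ‖ψ (β - 1)‖ := by
    rw [norm_mul, Complex.norm_real, Real.norm_eq_abs]
    exact mul_le_of_le_one_left (norm_nonneg _) (Sv_abs _ _ _ (by push_cast; simp))
  have k2 : ‖((Sv α (β + 1) - Sv α β : ℝ) : ℂ) * ψ (β + 1)‖ ≤ ‖ψ (β + 1)‖ := by
    rw [norm_mul, Complex.norm_real, Real.norm_eq_abs]
    exact mul_le_of_le_one_left (norm_nonneg _) (Sv_abs _ _ _ (by push_cast; simp))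
  have k3 := pow_le_pow_left₀ (norm_nonneg _) k1 2
  have k4 := pow_le_pow_left₀ (norm_nonneg _) k2 2
  refine (norm_sq_sub_le _ _).trans ?_
  have := norm_sq_sub_le (((Sv α (β - 1) - Sv α β : ℝ) : ℂ) * ψ (β - 1))
    (((Sv α (β + 1) - Sv α β : ℝ) : ℂ) * ψ (β + 1))
  linarith

theorem difference_interpolation (α : ℝ) (hα : 1 < |α|) (ψ : ℤ → ℂ)
    (hψ : RapidlyDecayingSeq ψ) :
    (∑' β : ℤ, (Sv α β - 1) ^ 2 * ‖ψ (β - 1) - ψ (β + 1)‖ ^ 2) ≤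
      2 * (∑' β : ℤ, ‖useq α ψ (β - 1) - useq α ψ (β + 1)‖ ^ 2)
        + 8 * ∑' β : ℤ, ‖ψ β‖ ^ 2 := by
  have s0 : Summable (fun β : ℤ => ‖ψ β‖ ^ 2) := by simpa using hψ 0
  have hα2 : 1 ≤ α ^ 2 := by nlinarith [sq_abs α]
  have su : Summable (fun β : ℤ => ‖useq α ψ β‖ ^ 2) := by
    refine Summable.of_nonneg_of_le (fun _ => by positivity) (fun β => ?_) ((hψ 1).mul_left (α ^ 2))
    have h1 : Sv α β ^ 2 = α ^ 2 + (β : ℝ) ^ 2 := Real.sq_sqrt (by positivity)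
    have h2 : 1 ≤ Sv α β := Real.one_le_sqrt.2 (by nlinarith [sq_nonneg (β : ℝ)])
    unfold useq
    rw [norm_mul, mul_pow, Complex.norm_real, Real.norm_eq_abs, sq_abs, pow_one, ← mul_assoc]
    refine mul_le_mul_of_nonneg_right ?_ (by positivity)
    nlinarith [mul_nonneg (sub_nonneg.2 hα2) (sq_nonneg (β : ℝ))]
  have shm : ∀ f : ℤ → ℝ, Summable f → Summable (fun β => f (β - 1)) := fun f hf =>
    (Equiv.subRight (1 : ℤ)).summable_iff.2 hf
  have shp : ∀ f : ℤ → ℝ, Summable f → Summable (fun β => f (β + 1)) := fun f hf =>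
    (Equiv.addRight (1 : ℤ)).summable_iff.2 hf
  have sd : Summable (fun β : ℤ => ‖useq α ψ (β - 1) - useq α ψ (β + 1)‖ ^ 2) :=
    Summable.of_nonneg_of_le (fun _ => by positivity) (fun β => norm_sq_sub_le _ _)
      (((shm _ su).mul_left 2).add ((shp _ su).mul_left 2))
  have m := (shm _ s0).mul_left 4
  have p := (shp _ s0).mul_left 4
  have sr := (sd.mul_left 2).add (m.add p)
  have sl := Summable.of_nonneg_of_le (fun β => by positivity) (pointwise_bd α ψ) sr
  refine (sl.tsum_le_tsum (pointwise_bd α ψ) sr).trans (le_of_eq ?_)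
  rw [(sd.mul_left 2).tsum_add (m.add p), m.tsum_add p, tsum_mul_left, tsum_mul_left, tsum_mul_left]
  have e1 : ∑' β : ℤ, ‖ψ (β - 1)‖ ^ 2 = ∑' β : ℤ, ‖ψ β‖ ^ 2 :=
    (Equiv.subRight (1 : ℤ)).tsum_eq (fun β => ‖ψ β‖ ^ 2)
  have e2 : ∑' β : ℤ, ‖ψ (β + 1)‖ ^ 2 = ∑' β : ℤ, ‖ψ β‖ ^ 2 :=
    (Equiv.addRight (1 : ℤ)).tsum_eq (fun β => ‖ψ β‖ ^ 2)
  rw [e1, e2]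
  ring
end

section
/- There exists a universal constant C > 0 such that for every real α with |α| > 1 and every rapidly decaying ψ : ℤ → ℂ, Σ_β [ (S(β) − 1)² / ( (S(β−1) + S(β+1)) · S(β−1) · S(β+1) ) ] · β² |ψ(β)|² ≥ (1/C) Σ_β (β² / S(β)) |ψ(β)|². -/
theorem Sv_one_lt (α : ℝ) (h : 1 < α ^ 2) (β : ℤ) : 1 < Sv α β := by
  unfold Sv
  rw [Real.lt_sqrt (by norm_num)]
  nlinarith [sq_nonneg (β : ℝ)]

theorem Sv_sq (α : ℝ) (β : ℤ) : Sv α β ^ 2 = α ^ 2 + (β : ℝ) ^ 2 := by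
  unfold Sv
  exact Real.sq_sqrt (by positivity)

theorem Sv_shift (α : ℝ) (h : 1 < α ^ 2) (β γ : ℤ) (hg : ((γ : ℝ) - β) ^ 2 = 1) :
    Sv α γ ≤ 2 * Sv α β := by
  have h1 := Sv_one_lt α h β
  apply (fun H => abs_le_of_sq_le_sq' H (by linarith) |>.2 : Sv α γ ^ 2 ≤ (2 * Sv α β) ^ 2 → _)
  rw [mul_pow, Sv_sq, Sv_sq]
  nlinarith [sq_nonneg ((γ : ℝ) - 2 * β)]

theorem coef_lower (α : ℝ) (h : 1 < α ^ 2) (β : ℤ) (hb : β ≠ 0) :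
    1 / 256 * (1 / Sv α β) ≤ (Sv α β - 1) ^ 2 /
      ((Sv α (β - 1) + Sv α (β + 1)) * Sv α (β - 1) * Sv α (β + 1)) := by
  have h0 := Sv_one_lt α h β
  have h1 := Sv_one_lt α h (β - 1)
  have h2 := Sv_one_lt α h (β + 1)
  have k1 := Sv_shift α h β (β - 1) (by push_cast; ring)
  have k2 := Sv_shift α h β (β + 1) (by push_cast; ring)
  have hs := Sv_sq α β
  have hb1 : (1 : ℝ) ≤ (β : ℝ) ^ 2 := by
    have : (1 : ℤ) ≤ β ^ 2 := by have := sq_pos_of_ne_zero hb; omega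
    exact_mod_cast this
  generalize Sv α β = s at *
  generalize Sv α (β - 1) = a at *
  generalize Sv α (β + 1) = b at *
  have h43 : 4 / 3 ≤ s := by nlinarith
  have hden : (a + b) * a * b ≤ (2 * s + 2 * s) * (2 * s) * (2 * s) := by gcongr
  have hnum : (s / 4) ^ 2 ≤ (s - 1) ^ 2 := by
    apply pow_le_pow_left₀ <;> linarith
  calc 1 / 256 * (1 / s) = (s / 4) ^ 2 / ((2 * s + 2 * s) * (2 * s) * (2 * s)) := by
        field_simp; norm_num
    _ ≤ _ := by
        apply div_le_div₀ (by positivity) hnum (by positivity) hden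

theorem coef_upper (α : ℝ) (h : 1 < α ^ 2) (β : ℤ) :
    (Sv α β - 1) ^ 2 /
      ((Sv α (β - 1) + Sv α (β + 1)) * Sv α (β - 1) * Sv α (β + 1)) ≤
      α ^ 2 * (1 + (β : ℝ) ^ 2) := by
  have h0 := Sv_one_lt α h β
  have h1 := Sv_one_lt α h (β - 1)
  have h2 := Sv_one_lt α h (β + 1)
  have hs := Sv_sq α β
  generalize Sv α β = s at *
  generalize Sv α (β - 1) = a at *
  generalize Sv α (β + 1) = b at *
  have hden : (1 : ℝ) ≤ (a + b) * a * b := by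
    calc (1 : ℝ) ≤ (1 + 1) * 1 * 1 := by norm_num
      _ ≤ _ := by gcongr
  refine (div_le_self (by positivity) hden).trans ?_
  nlinarith [sq_nonneg (β : ℝ)]

theorem commutator_coercivity :
    ∃ C : ℝ, 0 < C ∧
      ∀ α : ℝ, 1 < |α| → ∀ ψ : ℤ → ℂ, RapidlyDecayingSeq ψ →
        (∑' β : ℤ, ((Sv α β - 1) ^ 2 /
            ((Sv α (β - 1) + Sv α (β + 1)) * Sv α (β - 1) * Sv α (β + 1)))
              * (β : ℝ) ^ 2 * ‖ψ β‖ ^ 2) ≥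
          (1 / C) * ∑' β : ℤ, ((β : ℝ) ^ 2 / Sv α β) * ‖ψ β‖ ^ 2 := by
  refine ⟨256, by norm_num, ?_⟩
  intro α hα ψ hψ
  have h : 1 < α ^ 2 := by
    rw [← sq_abs]; nlinarith
  have hlow : ∀ β : ℤ, 1 / 256 * (((β : ℝ) ^ 2 / Sv α β) * ‖ψ β‖ ^ 2) ≤
      ((Sv α β - 1) ^ 2 /
            ((Sv α (β - 1) + Sv α (β + 1)) * Sv α (β - 1) * Sv α (β + 1)))
              * (β : ℝ) ^ 2 * ‖ψ β‖ ^ 2 := by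
    intro β
    by_cases hb : β = 0
    · simp [hb]
    · calc _ = (1 / 256 * (1 / Sv α β)) * (β : ℝ) ^ 2 * ‖ψ β‖ ^ 2 := by ring
        _ ≤ _ := by
          gcongr
          exact coef_lower α h β hb
  have hnn : ∀ β : ℤ, 0 ≤ 1 / 256 * (((β : ℝ) ^ 2 / Sv α β) * ‖ψ β‖ ^ 2) := by
    intro β
    have := Sv_one_lt α h β
    positivity
  have hsum : Summable (fun β : ℤ => ((Sv α β - 1) ^ 2 /
            ((Sv α (β - 1) + Sv α (β + 1)) * Sv α (β - 1) * Sv α (β + 1)))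
              * (β : ℝ) ^ 2 * ‖ψ β‖ ^ 2) := by
    refine Summable.of_nonneg_of_le (fun β => (hnn β).trans (hlow β)) (fun β => ?_)
      ((hψ 2).mul_left (α ^ 2))
    calc _ ≤ (α ^ 2 * (1 + (β : ℝ) ^ 2)) * (1 + (β : ℝ) ^ 2) * ‖ψ β‖ ^ 2 := by
          gcongr
          · exact coef_upper α h β
          · linarith
      _ = _ := by ring
  rw [ge_iff_le, ← tsum_mul_left]
  exact Summable.tsum_le_tsum hlow (Summable.of_nonneg_of_le hnn hlow hsum) hsum
end

section
/- Let f : ℝ → ℂ be continuously differentiable and 2π-periodic. Then ∫₀^{2π} |f(y)|² dy ≤ 2 ( ∫₀^{2π} |d/dy (cos y · f(y))|² dy )^{1/2} · ( ∫₀^{2π} |sin y · f(y)|² dy )^{1/2}. -/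
open scoped Real

theorem sin_cos_interpolation (f : ℝ → ℂ) (hf : ContDiff ℝ 1 f)
    (hper : Function.Periodic f (2 * π)) :
    (∫ y in (0 : ℝ)..(2 * π), ‖f y‖ ^ 2) ≤
      2 * Real.sqrt (∫ y in (0 : ℝ)..(2 * π),
            ‖deriv (fun x => (Real.cos x : ℂ) * f x) y‖ ^ 2)
        * Real.sqrt (∫ y in (0 : ℝ)..(2 * π), ‖(Real.sin y : ℂ) * f y‖ ^ 2) := by
  have hfc : Continuous f := hf.continuous
  have hfd : Continuous (deriv f) := hf.continuous_deriv le_rfl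
  have hd : ∀ y, HasDerivAt f (deriv f y) y := fun y =>
    (hf.differentiable (by norm_num) y).hasDerivAt
  have hG : deriv (fun x => (Real.cos x : ℂ) * f x) =
      fun y => ((-Real.sin y : ℝ) : ℂ) * f y + (Real.cos y : ℂ) * deriv f y := by
    funext y
    exact ((Real.hasDerivAt_cos y).ofReal_comp.mul (hd y)).deriv
  rw [hG]
  set G : ℝ → ℂ := fun y => ((-Real.sin y : ℝ) : ℂ) * f y + (Real.cos y : ℂ) * deriv f y with hGdef
  have hGc : Continuous G := by fun_prop
  set S : ℝ → ℂ := fun y => (Real.sin y : ℂ) * f y with hS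
  have hSc : Continuous S := by fun_prop
  have hI : Continuous (fun y => inner ℝ (G y) (S y)) := hGc.inner hSc
  have hprim : ∀ y, HasDerivAt (fun y => Real.sin y * Real.cos y * ‖f y‖ ^ 2)
      (‖f y‖ ^ 2 + 2 * inner ℝ (G y) (S y)) y := by
    intro y
    have h := ((Real.hasDerivAt_sin y).mul (Real.hasDerivAt_cos y)).mul (hd y).norm_sq
    refine h.congr_deriv ?_
    have h1 := Real.sin_sq_add_cos_sq y
    simp only [hGdef, hS, Complex.inner, ← Complex.normSq_eq_norm_sq, Complex.normSq_apply]
    simp [-Complex.ofReal_sin, -Complex.ofReal_cos]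
    linear_combination (-((f y).re*(f y).re+(f y).im*(f y).im)) * (- h1)
  have hint := intervalIntegral.integral_eq_sub_of_hasDerivAt (a := 0) (b := 2 * π)
    (fun y _ => hprim y) (Continuous.intervalIntegrable (by fun_prop) _ _)
  rw [intervalIntegral.integral_add (Continuous.intervalIntegrable (by fun_prop) _ _)
    (Continuous.intervalIntegrable (by fun_prop) _ _), intervalIntegral.integral_const_mul] at hint
  simp only [Real.sin_two_pi, Real.sin_zero, zero_mul, sub_zero] at hint
  set F := ∫ y in (0 : ℝ)..(2 * π), ‖f y‖ ^ 2
  change F ≤ 2 * √(∫ y in (0 : ℝ)..(2 * π), ‖G y‖ ^ 2) * √(∫ y in (0 : ℝ)..(2 * π), ‖S y‖ ^ 2)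
  have hq : ∀ t : ℝ, 0 ≤ (∫ y in (0 : ℝ)..(2 * π), ‖G y‖ ^ 2) * (t * t) + (-F) * t
      + ∫ y in (0 : ℝ)..(2 * π), ‖S y‖ ^ 2 := by
    intro t
    have h0 : 0 ≤ ∫ y in (0 : ℝ)..(2 * π),
        ((t * t) * ‖G y‖ ^ 2 + (2 * t) * inner ℝ (G y) (S y) + ‖S y‖ ^ 2) := by
      refine intervalIntegral.integral_nonneg (by positivity) fun y _ => ?_
      have h2 := norm_add_sq_real (t • G y) (S y)
      rw [norm_smul, real_inner_smul_left, mul_pow, Real.norm_eq_abs, sq_abs] at h2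
      nlinarith [sq_nonneg ‖t • G y + S y‖]
    rw [intervalIntegral.integral_add (Continuous.intervalIntegrable (by fun_prop) _ _)
      (Continuous.intervalIntegrable (by fun_prop) _ _),
      intervalIntegral.integral_add (Continuous.intervalIntegrable (by fun_prop) _ _)
      (Continuous.intervalIntegrable (by fun_prop) _ _), intervalIntegral.integral_const_mul,
      intervalIntegral.integral_const_mul] at h0
    linear_combination h0 + t * hint
  have hA : 0 ≤ ∫ y in (0 : ℝ)..(2 * π), ‖G y‖ ^ 2 :=
    intervalIntegral.integral_nonneg (by positivity) fun y _ => by positivity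
  have hB : 0 ≤ ∫ y in (0 : ℝ)..(2 * π), ‖S y‖ ^ 2 :=
    intervalIntegral.integral_nonneg (by positivity) fun y _ => by positivity
  have hdis := discrim_le_zero hq
  unfold discrim at hdis
  refine abs_le_of_sq_le_sq' ?_ (by positivity) |>.2
  rw [mul_pow, mul_pow, Real.sq_sqrt hA, Real.sq_sqrt hB]
  linarith
end

section
/- Let α be real with |α| ≥ 1 and let z : ℤ → ℂ be square-summable. Then Σ_β | (1−2β) z(β−1) / (S(β−1) + S(β)) − (1+2β) z(β+1) / (S(β+1) + S(β)) |² ≤ 16 Σ_β |z(β)|². -/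
theorem Sv_abs_le (α : ℝ) (β : ℤ) : |(β : ℝ)| ≤ Sv α β := by
  unfold Sv
  apply Real.abs_le_sqrt
  nlinarith [sq_nonneg α]

theorem coef_le (α c : ℝ) (a b : ℤ) (h : |c| ≤ |(a : ℝ)| + |(b : ℝ)|) :
    |c / (Sv α a + Sv α b)| ≤ 1 := by
  have h1 := Sv_abs_le α a
  have h2 := Sv_abs_le α b
  have h3 : 0 ≤ Sv α a + Sv α b := by
    have := abs_nonneg (a : ℝ)
    have := abs_nonneg (b : ℝ)
    linarith
  rw [abs_div, abs_of_nonneg h3]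
  exact div_le_one_of_le₀ (by linarith) h3

theorem term_le (c d : ℝ) (hc : |c| ≤ 1) (hd : |d| ≤ 1) (x y : ℂ) :
    ‖(c : ℂ) * x - (d : ℂ) * y‖ ^ 2 ≤ 2 * ‖x‖ ^ 2 + 2 * ‖y‖ ^ 2 := by
  have h1 : ‖(c : ℂ) * x‖ ≤ ‖x‖ := by
    rw [norm_mul, Complex.norm_real, Real.norm_eq_abs]
    exact mul_le_of_le_one_left (norm_nonneg x) hc
  have h2 : ‖(d : ℂ) * y‖ ≤ ‖y‖ := by
    rw [norm_mul, Complex.norm_real, Real.norm_eq_abs]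
    exact mul_le_of_le_one_left (norm_nonneg y) hd
  have h3 : ‖(c : ℂ) * x - (d : ℂ) * y‖ ≤ ‖x‖ + ‖y‖ := (norm_sub_le _ _).trans (add_le_add h1 h2)
  have h4 := pow_le_pow_left₀ (norm_nonneg _) h3 2
  nlinarith [sq_nonneg (‖x‖ - ‖y‖)]

theorem shift_aux (f : ℤ → ℝ) (hf : Summable f) (k : ℤ) :
    Summable (fun β : ℤ => f (β + k)) ∧ ∑' β : ℤ, f (β + k) = ∑' β : ℤ, f β :=
  ⟨(Equiv.addRight k).summable_iff.mpr hf, (Equiv.addRight k).tsum_eq f⟩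

theorem coef1 (α : ℝ) (β : ℤ) : |(1 - 2 * (β : ℝ)) / (Sv α (β - 1) + Sv α β)| ≤ 1 := by
  apply coef_le
  push_cast
  have := abs_add_le ((β : ℝ) - 1) β
  rw [abs_sub_comm 1 (2 * (β : ℝ))]
  rwa [show (β : ℝ) - 1 + β = 2 * β - 1 by ring] at this

theorem coef2 (α : ℝ) (β : ℤ) : |(1 + 2 * (β : ℝ)) / (Sv α (β + 1) + Sv α β)| ≤ 1 := by
  apply coef_le
  push_cast
  have := abs_add_le ((β : ℝ) + 1) β
  rwa [show (β : ℝ) + 1 + β = 1 + 2 * β by ring] at this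

theorem sin_commutator_bound (α : ℝ) (hα : 1 ≤ |α|) (z : ℤ → ℂ)
    (hz : Summable fun β : ℤ => ‖z β‖ ^ 2) :
    (∑' β : ℤ, ‖(((1 - 2 * (β : ℝ)) / (Sv α (β - 1) + Sv α β) : ℝ) : ℂ) * z (β - 1)
        - (((1 + 2 * (β : ℝ)) / (Sv α (β + 1) + Sv α β) : ℝ) : ℂ) * z (β + 1)‖ ^ 2)
      ≤ 16 * ∑' β : ℤ, ‖z β‖ ^ 2 := by
  obtain ⟨hs1, e1⟩ := shift_aux (fun β => ‖z β‖ ^ 2) hz (-1)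
  obtain ⟨hs2, e2⟩ := shift_aux (fun β => ‖z β‖ ^ 2) hz 1
  simp only [← sub_eq_add_neg] at hs1 e1
  have hb : Summable fun β : ℤ => 2 * ‖z (β - 1)‖ ^ 2 + 2 * ‖z (β + 1)‖ ^ 2 :=
    (hs1.mul_left 2).add (hs2.mul_left 2)
  have key : ∀ β : ℤ, ‖(((1 - 2 * (β : ℝ)) / (Sv α (β - 1) + Sv α β) : ℝ) : ℂ) * z (β - 1)
        - (((1 + 2 * (β : ℝ)) / (Sv α (β + 1) + Sv α β) : ℝ) : ℂ) * z (β + 1)‖ ^ 2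
      ≤ 2 * ‖z (β - 1)‖ ^ 2 + 2 * ‖z (β + 1)‖ ^ 2 := by
    intro β
    exact term_le _ _ (coef1 α β) (coef2 α β) _ _
  generalize hF : (fun β : ℤ => ‖(((1 - 2 * (β : ℝ)) / (Sv α (β - 1) + Sv α β) : ℝ) : ℂ) * z (β - 1)
        - (((1 + 2 * (β : ℝ)) / (Sv α (β + 1) + Sv α β) : ℝ) : ℂ) * z (β + 1)‖ ^ 2) = F
  have hF0 : ∀ β, 0 ≤ F β := by
    intro β
    rw [← hF]
    positivity
  have key : ∀ β, F β ≤ 2 * ‖z (β - 1)‖ ^ 2 + 2 * ‖z (β + 1)‖ ^ 2 := by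
    intro β
    rw [← hF]
    exact key β
  clear hF
  have hl : Summable F := Summable.of_nonneg_of_le hF0 key hb
  have h0 : 0 ≤ ∑' β : ℤ, ‖z β‖ ^ 2 := tsum_nonneg fun β => sq_nonneg _
  refine (Summable.tsum_le_tsum key hl hb).trans ?_
  rw [(hs1.mul_left 2).tsum_add (hs2.mul_left 2), tsum_mul_left, tsum_mul_left, e1, e2]
  linarith
end
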